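/- arXiv:2303.18152 — 2 statements merged into one kernel-verified Lean document; each statement's English description precedes it below -/
import Mathlib

section
/- Let T be a bounded linear operator on a complex Hilbert space H and λ ≥ 0. Then w(T)⁴ ≤ ((2λ+3)/(8(λ+1)))·‖|T|² + |T*|²‖·w(T²) + ((2λ+1)/(8(λ+1)))·‖|T|⁴ + |T*|⁴‖, where w denotes the numerical radius and |T| = (T*T)^{1/2}. -/
open scoped InnerProductSpace NNReal
open ContinuousLinearMap

variable {H : Type*} [NormedAddCommGroup H] [InnerProductSpace ℂ H]

noncomputable def numRadius [CompleteSpace H] (T : H →L[ℂ] H) : ℝ :=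
  ⨆ x : {x : H // ‖x‖ = 1}, ‖⟪T x, (x : H)⟫_ℂ‖

noncomputable def opAbs [CompleteSpace H] (T : H →L[ℂ] H) : H →L[ℂ] H :=
  CFC.sqrt (ContinuousLinearMap.adjoint T * T)

/-- Buzano's inequality. -/
theorem norm_inner_mul_inner_le (x a b : H) (hx : ‖x‖ = 1) :
    2 * (‖⟪a, x⟫_ℂ‖ * ‖⟪x, b⟫_ℂ‖) ≤ ‖a‖ * ‖b‖ + ‖⟪a, b⟫_ℂ‖ := by
  have hy : (ℂ ∙ x).reflection a = 2 • ⟪x, a⟫_ℂ • x - a := by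
    rw [Submodule.reflection_singleton_apply]
    simp [hx]
  have hi : 2 * (⟪a, x⟫_ℂ * ⟪x, b⟫_ℂ) = ⟪(ℂ ∙ x).reflection a, b⟫_ℂ + ⟪a, b⟫_ℂ := by
    rw [hy, two_smul, inner_sub_left, inner_add_left, inner_smul_left, inner_conj_symm]
    ring
  calc 2 * (‖⟪a, x⟫_ℂ‖ * ‖⟪x, b⟫_ℂ‖) = ‖2 * (⟪a, x⟫_ℂ * ⟪x, b⟫_ℂ)‖ := by simp
    _ ≤ ‖⟪(ℂ ∙ x).reflection a, b⟫_ℂ‖ + ‖⟪a, b⟫_ℂ‖ := hi ▸ norm_add_le _ _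
    _ ≤ ‖a‖ * ‖b‖ + ‖⟪a, b⟫_ℂ‖ := by
      have h := norm_inner_le_norm (𝕜 := ℂ) ((ℂ ∙ x).reflection a) b
      rw [LinearIsometryEquiv.norm_map] at h
      gcongr

theorem numRadius_nonneg [CompleteSpace H] (T : H →L[ℂ] H) : 0 ≤ numRadius T :=
  Real.iSup_nonneg fun _ => norm_nonneg _

theorem norm_inner_le_numRadius [CompleteSpace H] (T : H →L[ℂ] H) (x : H) (hx : ‖x‖ = 1) :
    ‖⟪T x, x⟫_ℂ‖ ≤ numRadius T := by
  refine le_ciSup (f := fun x : {x : H // ‖x‖ = 1} => ‖⟪T x, (x : H)⟫_ℂ‖) ⟨‖T‖, ?_⟩ ⟨x, hx⟩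
  rintro _ ⟨⟨y, hy⟩, rfl⟩
  calc ‖⟪T y, y⟫_ℂ‖ ≤ ‖T y‖ * ‖y‖ := norm_inner_le_norm _ _
    _ ≤ ‖T‖ := by simpa [hy] using T.le_opNorm y

theorem opAbs_sq [CompleteSpace H] (T : H →L[ℂ] H) : opAbs T ^ 2 = adjoint T * T :=
  CFC.sq_sqrt _ (star_mul_self_nonneg T)

theorem opAbs_pow_four [CompleteSpace H] (T : H →L[ℂ] H) :
    opAbs T ^ 4 = (adjoint T * T) * (adjoint T * T) := by
  rw [← opAbs_sq, ← pow_add]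

theorem norm_sq_add_norm_sq_le [CompleteSpace H] (T : H →L[ℂ] H) (x : H) (hx : ‖x‖ = 1) :
    ‖T x‖ ^ 2 + ‖adjoint T x‖ ^ 2 ≤ ‖opAbs T ^ 2 + opAbs (adjoint T) ^ 2‖ := by
  have h : ⟪(opAbs T ^ 2 + opAbs (adjoint T) ^ 2) x, x⟫_ℂ
      = ((‖T x‖ ^ 2 + ‖adjoint T x‖ ^ 2 : ℝ) : ℂ) := by
    rw [opAbs_sq, opAbs_sq, adjoint_adjoint, add_apply, mul_apply_eq_comp, mul_apply_eq_comp,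
      inner_add_left, adjoint_inner_left, ← adjoint_inner_right T (adjoint T x) x,
      inner_self_eq_norm_sq_to_K, inner_self_eq_norm_sq_to_K]
    push_cast
    rfl
  have h' := (norm_inner_le_norm (𝕜 := ℂ) ((opAbs T ^ 2 + opAbs (adjoint T) ^ 2) x) x).trans
    (mul_le_mul_of_nonneg_right (le_opNorm _ x) (norm_nonneg x))
  rwa [h, Complex.norm_real, Real.norm_of_nonneg (by positivity), hx, mul_one, mul_one] at h'

theorem norm_opAbs_sq_apply_sq_add_le [CompleteSpace H] (T : H →L[ℂ] H) (x : H) :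
    ‖(opAbs T ^ 2) x‖ ^ 2 + ‖(opAbs (adjoint T) ^ 2) x‖ ^ 2
      ≤ ‖opAbs T ^ 4 + opAbs (adjoint T) ^ 4‖ * ‖x‖ ^ 2 := by
  have key (S : H →L[ℂ] H) : ⟪(opAbs S ^ 4) x, x⟫_ℂ = ((‖(opAbs S ^ 2) x‖ ^ 2 : ℝ) : ℂ) := by
    rw [opAbs_pow_four, opAbs_sq, mul_apply_eq_comp, mul_apply_eq_comp, adjoint_inner_left,
      ← adjoint_inner_right, ← mul_apply_eq_comp, inner_self_eq_norm_sq_to_K]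
    push_cast
    rfl
  have h' := (norm_inner_le_norm (𝕜 := ℂ) ((opAbs T ^ 4 + opAbs (adjoint T) ^ 4) x) x).trans
    (mul_le_mul_of_nonneg_right (le_opNorm _ x) (norm_nonneg x))
  rw [add_apply, inner_add_left, key, key, ← Complex.ofReal_add, Complex.norm_real,
    Real.norm_of_nonneg (by positivity)] at h'
  linarith

theorem norm_sq_le_norm_opAbs_sq_apply [CompleteSpace H] (T : H →L[ℂ] H) (x : H)
    (hx : ‖x‖ = 1) : ‖T x‖ ^ 2 ≤ ‖(opAbs T ^ 2) x‖ := by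
  have h := norm_inner_le_norm (𝕜 := ℂ) ((opAbs T ^ 2) x) x
  rw [opAbs_sq, mul_apply_eq_comp, adjoint_inner_left, inner_self_eq_norm_sq_to_K] at h
  rw [opAbs_sq, mul_apply_eq_comp]
  simpa [hx] using h

theorem norm_pow_four_add_le [CompleteSpace H] (T : H →L[ℂ] H) (x : H) (hx : ‖x‖ = 1) :
    ‖T x‖ ^ 4 + ‖adjoint T x‖ ^ 4 ≤ ‖opAbs T ^ 4 + opAbs (adjoint T) ^ 4‖ := by
  have h := norm_opAbs_sq_apply_sq_add_le T x
  have h₁ := pow_le_pow_left₀ (by positivity) (norm_sq_le_norm_opAbs_sq_apply T x hx) 2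
  have h₂ := pow_le_pow_left₀ (by positivity) (norm_sq_le_norm_opAbs_sq_apply (adjoint T) x hx) 2
  rw [hx] at h
  linarith

theorem norm_opAbs_sq_add_sq_le [CompleteSpace H] (T : H →L[ℂ] H) :
    ‖opAbs T ^ 2 + opAbs (adjoint T) ^ 2‖ ^ 2 ≤ 2 * ‖opAbs T ^ 4 + opAbs (adjoint T) ^ 4‖ := by
  rw [← Real.le_sqrt (norm_nonneg _) (by positivity)]
  refine opNorm_le_bound _ (Real.sqrt_nonneg _) fun x => ?_
  refine le_of_sq_le_sq ?_ (by positivity)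
  rw [mul_pow, Real.sq_sqrt (by positivity)]
  have h := norm_opAbs_sq_apply_sq_add_le T x
  have h₁ := pow_le_pow_left₀ (norm_nonneg _)
    (norm_add_le ((opAbs T ^ 2) x) ((opAbs (adjoint T) ^ 2) x)) 2
  rw [add_apply]
  nlinarith [sq_nonneg (‖(opAbs T ^ 2) x‖ - ‖(opAbs (adjoint T) ^ 2) x‖)]

theorem inner_pow_two_apply [CompleteSpace H] (T : H →L[ℂ] H) (x : H) :
    ⟪(T ^ 2) x, x⟫_ℂ = ⟪T x, adjoint T x⟫_ℂ := by
  rw [adjoint_inner_right, pow_two, mul_apply_eq_comp]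

theorem two_mul_numRadius_sq_le [CompleteSpace H] (T : H →L[ℂ] H) :
    2 * numRadius (T ^ 2) ≤ ‖opAbs T ^ 2 + opAbs (adjoint T) ^ 2‖ := by
  rw [← le_div_iff₀' two_pos]
  refine Real.iSup_le ?_ (by positivity)
  rintro ⟨x, hx⟩
  rw [inner_pow_two_apply]
  have h := norm_inner_le_norm (𝕜 := ℂ) (T x) (adjoint T x)
  nlinarith [norm_sq_add_norm_sq_le T x hx, sq_nonneg (‖T x‖ - ‖adjoint T x‖)]

theorem norm_inner_pow_four_le [CompleteSpace H] (T : H →L[ℂ] H) (x : H) (hx : ‖x‖ = 1) :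
    ‖⟪T x, x⟫_ℂ‖ ^ 4 ≤
      3 / 8 * (‖opAbs T ^ 2 + opAbs (adjoint T) ^ 2‖ * numRadius (T ^ 2))
        + 1 / 8 * ‖opAbs T ^ 4 + opAbs (adjoint T) ^ 4‖ := by
  have hbuz := norm_inner_mul_inner_le x (T x) (adjoint T x) hx
  rw [adjoint_inner_right T x x] at hbuz
  have hcs := norm_inner_le_norm (𝕜 := ℂ) (T x) (adjoint T x)
  have hw := norm_inner_le_numRadius (T ^ 2) x hx
  rw [inner_pow_two_apply] at hw
  have hA := norm_sq_add_norm_sq_le T x hx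
  have hB := norm_pow_four_add_le T x hx
  set a := ‖T x‖ * ‖adjoint T x‖ with ha
  set c := ‖⟪T x, adjoint T x⟫_ℂ‖
  set A := ‖opAbs T ^ 2 + opAbs (adjoint T) ^ 2‖
  have hc : 0 ≤ c := norm_nonneg _
  have ha2 : 2 * a ≤ A := by nlinarith [sq_nonneg (‖T x‖ - ‖adjoint T x‖)]
  have ha4 : 2 * a ^ 2 ≤ ‖opAbs T ^ 4 + opAbs (adjoint T) ^ 4‖ := by
    nlinarith [sq_nonneg (‖T x‖ ^ 2 - ‖adjoint T x‖ ^ 2)]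
  have hac : 2 * a * c ≤ A * numRadius (T ^ 2) :=
    mul_le_mul ha2 hw hc (norm_nonneg _)
  have hcc : c * c ≤ a * c := mul_le_mul_of_nonneg_right hcs hc
  have hsq := pow_le_pow_left₀ (by positivity) hbuz 2
  nlinarith

theorem numRadius_pow_four_le [CompleteSpace H] (T : H →L[ℂ] H) :
    numRadius T ^ 4 ≤
      3 / 8 * (‖opAbs T ^ 2 + opAbs (adjoint T) ^ 2‖ * numRadius (T ^ 2))
        + 1 / 8 * ‖opAbs T ^ 4 + opAbs (adjoint T) ^ 4‖ := by
  have h₀ := numRadius_nonneg (T ^ 2)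
  set R := 3 / 8 * (‖opAbs T ^ 2 + opAbs (adjoint T) ^ 2‖ * numRadius (T ^ 2))
        + 1 / 8 * ‖opAbs T ^ 4 + opAbs (adjoint T) ^ 4‖
  have hR₀ : 0 ≤ R := by positivity
  have h : numRadius T ≤ √√R := by
    refine Real.iSup_le ?_ (Real.sqrt_nonneg _)
    rintro ⟨x, hx⟩
    refine Real.le_sqrt_of_sq_le (Real.le_sqrt_of_sq_le ?_)
    rw [← pow_mul]
    exact norm_inner_pow_four_le T x hx
  calc numRadius T ^ 4 ≤ (√√R) ^ 4 := pow_le_pow_left₀ (numRadius_nonneg T) h 4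
    _ = ((√√R) ^ 2) ^ 2 := by ring
    _ = R := by rw [Real.sq_sqrt (Real.sqrt_nonneg _), Real.sq_sqrt hR₀]

theorem stmt2 [CompleteSpace H] (T : H →L[ℂ] H) (l : ℝ) (hl : 0 ≤ l) :
    numRadius T ^ 4 ≤
      ((2 * l + 3) / (8 * (l + 1))) * ‖opAbs T ^ 2 + opAbs (adjoint T) ^ 2‖ * numRadius (T ^ 2)
        + ((2 * l + 1) / (8 * (l + 1))) * ‖opAbs T ^ 4 + opAbs (adjoint T) ^ 4‖ := by
  have h := numRadius_pow_four_le T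
  have h₁ := norm_opAbs_sq_add_sq_le T
  have h₂ := two_mul_numRadius_sq_le T
  set A := ‖opAbs T ^ 2 + opAbs (adjoint T) ^ 2‖
  set B := ‖opAbs T ^ 4 + opAbs (adjoint T) ^ 4‖
  set w := numRadius (T ^ 2)
  have hAB : A * w ≤ B := by nlinarith [norm_nonneg (opAbs T ^ 2 + opAbs (adjoint T) ^ 2)]
  have hl' : 0 < l + 1 := by linarith
  have hdiff : (2 * l + 3) / (8 * (l + 1)) * A * w + (2 * l + 1) / (8 * (l + 1)) * B
      = 3 / 8 * (A * w) + 1 / 8 * B + l / (8 * (l + 1)) * (B - A * w) := by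
    field_simp
    ring
  have hnn : 0 ≤ l / (8 * (l + 1)) * (B - A * w) :=
    mul_nonneg (by positivity) (sub_nonneg.2 hAB)
  linarith
end

section
/- Let T, S be bounded linear operators on a complex Hilbert space, λ ≥ 0 and r ≥ 1. Then (1/(2(λ+1)))·‖|T|^{2r} + |S|^{2r}‖·w(T*S)^r + (λ/(4(λ+1)))·‖|T|^{4r} + |S|^{4r}‖ + (λ/(2(λ+1)))·w(|S|^{2r}|T|^{2r}) ≤ (1/2)·‖|T|^{4r} + |S|^{4r}‖. -/
open scoped InnerProductSpace NNReal
open ContinuousLinearMap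

variable {H : Type*} [NormedAddCommGroup H] [InnerProductSpace ℂ H]

theorem opAbs_nonneg [CompleteSpace H] (T : H →L[ℂ] H) : 0 ≤ opAbs T :=
  CFC.sqrt_nonneg _

theorem adjoint_mul_self_nonneg [CompleteSpace H] (T : H →L[ℂ] H) : 0 ≤ adjoint T * T :=
  (nonneg_iff_isPositive _).2 (isPositive_adjoint_comp_self T)

theorem opAbs_rpow_two_mul [CompleteSpace H] (T : H →L[ℂ] H) {r : ℝ} (hr : 0 ≤ r) :
    opAbs T ^ (2 * r) = (adjoint T * T) ^ r := by
  rw [← CFC.rpow_rpow_of_exponent_nonneg _ 2 r (by norm_num) hr (opAbs_nonneg T)]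
  congr 1
  have h := CFC.rpow_natCast (opAbs T) 2 (opAbs_nonneg T)
  rw [Nat.cast_two] at h
  rw [h]
  exact CFC.sq_sqrt _ (adjoint_mul_self_nonneg T)

theorem opAbs_rpow_four_mul [CompleteSpace H] (T : H →L[ℂ] H) {r : ℝ} (hr : 0 ≤ r) :
    opAbs T ^ (4 * r) = opAbs T ^ (2 * r) * opAbs T ^ (2 * r) := by
  have h := CFC.rpow_natCast (opAbs T ^ (2 * r)) 2 CFC.rpow_nonneg
  rw [Nat.cast_two, CFC.rpow_rpow_of_exponent_nonneg _ _ _ (by positivity) (by norm_num)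
    (opAbs_nonneg T)] at h
  rw [← sq, ← h]
  ring_nf

theorem numRadius_le [CompleteSpace H] {T : H →L[ℂ] H} {c : ℝ} (hc : 0 ≤ c)
    (h : ∀ x : H, ‖x‖ = 1 → ‖⟪T x, x⟫_ℂ‖ ≤ c) : numRadius T ≤ c :=
  Real.iSup_le (fun x => h x x.2) hc

theorem re_inner_apply_le_norm (T : H →L[ℂ] H) {x : H} (hx : ‖x‖ = 1) :
    (⟪T x, x⟫_ℂ).re ≤ ‖T‖ :=
  calc (⟪T x, x⟫_ℂ).re ≤ ‖T x‖ * ‖x‖ := re_inner_le_norm (𝕜 := ℂ) (T x) x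
    _ ≤ ‖T‖ := by simpa [hx] using T.le_opNorm x

theorem tangent_line_le_rpow {a t r : ℝ} (ha : 0 < a) (ht : 0 ≤ t) (hr : 1 ≤ r) :
    (a ^ r - r * a ^ (r - 1) * a) + r * a ^ (r - 1) * t ≤ t ^ r := by
  have h := one_add_mul_self_le_rpow_one_add (s := t / a - 1)
    (by linarith [div_nonneg ht ha.le]) hr
  rw [add_sub_cancel, Real.div_rpow ht ha.le, le_div_iff₀ (Real.rpow_pos_of_pos ha r)] at h
  have e : a ^ r = a ^ (r - 1) * a := by
    rw [Real.rpow_sub_one ha.ne', div_mul_cancel₀ _ ha.ne']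
  refine le_trans (le_of_eq ?_) h
  rw [e]
  field_simp
  ring

/-- The Hölder–McCarthy inequality for exponents at least one. -/
theorem rpow_re_inner_le_re_inner_rpow [CompleteSpace H] {P : H →L[ℂ] H} (hP : 0 ≤ P) {r : ℝ}
    (hr : 1 ≤ r) {x : H} (hx : ‖x‖ = 1) :
    (⟪P x, x⟫_ℂ).re ^ r ≤ (⟪(P ^ r) x, x⟫_ℂ).re := by
  have hpos : 0 ≤ (⟪P x, x⟫_ℂ).re := ((nonneg_iff_isPositive P).1 hP).re_inner_nonneg_left x
  have hrpos : 0 ≤ (⟪(P ^ r) x, x⟫_ℂ).re :=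
    ((nonneg_iff_isPositive (P ^ r)).1 CFC.rpow_nonneg).re_inner_nonneg_left x
  set a := (⟪P x, x⟫_ℂ).re with ha_def
  rcases hpos.eq_or_lt with ha | ha
  · rwa [← ha, Real.zero_rpow (by linarith)]
  have hsa : IsSelfAdjoint P := .of_nonneg hP
  have hle : cfc (fun t : ℝ => (a ^ r - r * a ^ (r - 1) * a) + r * a ^ (r - 1) * t) P ≤
      cfc (fun t : ℝ => t ^ r) P := by
    refine cfc_mono (fun t ht => tangent_line_le_rpow ha (spectrum_nonneg_of_nonneg hP ht) hr)
      (by fun_prop) (Real.continuous_rpow_const (by linarith)).continuousOn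
  rw [← CFC.rpow_eq_cfc_real hP, cfc_const_add _ _ _, cfc_const_mul_id _ _, le_def] at hle
  have h := hle.re_inner_nonneg_left x
  simp [inner_sub_left, inner_add_left, Algebra.algebraMap_eq_smul_one,
    inner_smul_left_eq_star_smul, hx, ← ha_def] at h
  linarith

theorem norm_apply_rpow_two_mul_le [CompleteSpace H] (T : H →L[ℂ] H) {r : ℝ} (hr : 1 ≤ r) {x : H}
    (hx : ‖x‖ = 1) : (‖T x‖ ^ r) ^ 2 ≤ (⟪(opAbs T ^ (2 * r)) x, x⟫_ℂ).re := by
  have h := rpow_re_inner_le_re_inner_rpow (adjoint_mul_self_nonneg T) hr hx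
  rw [opAbs_rpow_two_mul T (by linarith)]
  refine le_trans (le_of_eq ?_) h
  have e : (⟪(adjoint T * T) x, x⟫_ℂ).re = ‖T x‖ ^ 2 := by
    rw [mul_apply_eq_comp, adjoint_inner_left]
    exact inner_self_eq_norm_sq (𝕜 := ℂ) (T x)
  rw [e, ← Real.rpow_natCast, ← Real.rpow_natCast, ← Real.rpow_mul (norm_nonneg _),
    ← Real.rpow_mul (norm_nonneg _), mul_comm]

/-- Dragomir's inequality. -/
theorem numRadius_adjoint_mul_rpow_le [CompleteSpace H] (T S : H →L[ℂ] H) {r : ℝ} (hr : 1 ≤ r) :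
    numRadius (adjoint T * S) ^ r ≤ 1 / 2 * ‖opAbs T ^ (2 * r) + opAbs S ^ (2 * r)‖ := by
  have hr0 : 0 < r := by linarith
  have hN : 0 ≤ 1 / 2 * ‖opAbs T ^ (2 * r) + opAbs S ^ (2 * r)‖ := by positivity
  rw [← Real.le_rpow_inv_iff_of_pos (numRadius_nonneg _) hN hr0]
  refine numRadius_le (by positivity) fun x hx => ?_
  rw [Real.le_rpow_inv_iff_of_pos (norm_nonneg _) hN hr0, mul_apply_eq_comp, adjoint_inner_left]
  have h1 : ‖⟪S x, T x⟫_ℂ‖ ^ r ≤ ‖S x‖ ^ r * ‖T x‖ ^ r := by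
    rw [← Real.mul_rpow (norm_nonneg _) (norm_nonneg _)]
    exact Real.rpow_le_rpow (norm_nonneg _) (norm_inner_le_norm _ _) hr0.le
  have hT := norm_apply_rpow_two_mul_le T hr hx
  have hS := norm_apply_rpow_two_mul_le S hr hx
  have h2 := re_inner_apply_le_norm (opAbs T ^ (2 * r) + opAbs S ^ (2 * r)) hx
  rw [add_apply, inner_add_left, Complex.add_re] at h2
  nlinarith [two_mul_le_add_sq (‖S x‖ ^ r) (‖T x‖ ^ r)]

theorem re_inner_mul_self_add_mul_self [CompleteSpace H] {A B : H →L[ℂ] H}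
    (hA : IsSelfAdjoint A) (hB : IsSelfAdjoint B) (x : H) :
    (⟪(A * A + B * B) x, x⟫_ℂ).re = ‖A x‖ ^ 2 + ‖B x‖ ^ 2 := by
  rw [add_apply, mul_apply_eq_comp, mul_apply_eq_comp, inner_add_left, Complex.add_re]
  have e {C : H →L[ℂ] H} (hC : IsSelfAdjoint C) : (⟪C (C x), x⟫_ℂ).re = ‖C x‖ ^ 2 :=
    (congrArg Complex.re (hC.isSymmetric (C x) x)).trans (inner_self_eq_norm_sq (𝕜 := ℂ) (C x))
  rw [e hA, e hB]

theorem norm_sq_add_norm_sq_le_s8 [CompleteSpace H] {A B : H →L[ℂ] H}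
    (hA : IsSelfAdjoint A) (hB : IsSelfAdjoint B) (x : H) :
    ‖A x‖ ^ 2 + ‖B x‖ ^ 2 ≤ ‖A * A + B * B‖ * ‖x‖ ^ 2 := by
  rw [← re_inner_mul_self_add_mul_self hA hB]
  calc (⟪(A * A + B * B) x, x⟫_ℂ).re ≤ ‖(A * A + B * B) x‖ * ‖x‖ :=
        re_inner_le_norm (𝕜 := ℂ) _ x
    _ ≤ ‖A * A + B * B‖ * ‖x‖ * ‖x‖ := by gcongr; exact le_opNorm _ _
    _ = _ := by ring

theorem numRadius_mul_le [CompleteSpace H] {A B : H →L[ℂ] H}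
    (hA : IsSelfAdjoint A) (hB : IsSelfAdjoint B) :
    numRadius (B * A) ≤ 1 / 2 * ‖A * A + B * B‖ := by
  refine numRadius_le (by positivity) fun x hx => ?_
  have h := norm_sq_add_norm_sq_le_s8 hA hB x
  have e : ⟪(B * A) x, x⟫_ℂ = ⟪A x, B x⟫_ℂ := hB.isSymmetric (A x) x
  rw [hx] at h
  rw [e]
  nlinarith [norm_inner_le_norm (𝕜 := ℂ) (A x) (B x), two_mul_le_add_sq ‖A x‖ ‖B x‖]

theorem sq_norm_add_le [CompleteSpace H] {A B : H →L[ℂ] H}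
    (hA : IsSelfAdjoint A) (hB : IsSelfAdjoint B) :
    ‖A + B‖ ^ 2 ≤ 2 * ‖A * A + B * B‖ := by
  have h : ‖A + B‖ ≤ √(2 * ‖A * A + B * B‖) := by
    refine opNorm_le_bound _ (Real.sqrt_nonneg _) fun x => ?_
    refine (sq_le_sq₀ (norm_nonneg _) (by positivity)).1 ?_
    rw [mul_pow, Real.sq_sqrt (by positivity), add_apply]
    have h1 : ‖A x + B x‖ ^ 2 ≤ (‖A x‖ + ‖B x‖) ^ 2 := by
      gcongr
      exact norm_add_le _ _
    nlinarith [norm_sq_add_norm_sq_le_s8 hA hB x, add_sq_le (a := ‖A x‖) (b := ‖B x‖)]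
  exact (Real.le_sqrt (norm_nonneg _) (by positivity)).1 h

theorem stmt8 [CompleteSpace H] (T S : H →L[ℂ] H) (l r : ℝ) (hl : 0 ≤ l) (hr : 1 ≤ r) :
    (1 / (2 * (l + 1))) * ‖opAbs T ^ (2 * r) + opAbs S ^ (2 * r)‖
        * numRadius (adjoint T * S) ^ r
      + (l / (4 * (l + 1))) * ‖opAbs T ^ (4 * r) + opAbs S ^ (4 * r)‖
      + (l / (2 * (l + 1))) * numRadius (opAbs S ^ (2 * r) * opAbs T ^ (2 * r)) ≤
    (1 / 2) * ‖opAbs T ^ (4 * r) + opAbs S ^ (4 * r)‖ := by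
  have hr0 : 0 ≤ r := by linarith
  have hA : IsSelfAdjoint (opAbs T ^ (2 * r)) := .of_nonneg CFC.rpow_nonneg
  have hB : IsSelfAdjoint (opAbs S ^ (2 * r)) := .of_nonneg CFC.rpow_nonneg
  have h1 := numRadius_adjoint_mul_rpow_le T S hr
  rw [opAbs_rpow_four_mul T hr0, opAbs_rpow_four_mul S hr0]
  have h2 := numRadius_mul_le hA hB
  have h3 := sq_norm_add_le hA hB
  generalize opAbs T ^ (2 * r) = A at *
  generalize opAbs S ^ (2 * r) = B at *
  set N := ‖A * A + B * B‖
  have h4 : ‖A + B‖ * numRadius (adjoint T * S) ^ r ≤ N := by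
    nlinarith [mul_le_mul_of_nonneg_left h1 (norm_nonneg (A + B))]
  calc _ = (1 / (2 * (l + 1))) * (‖A + B‖ * numRadius (adjoint T * S) ^ r)
        + (l / (4 * (l + 1))) * N + (l / (2 * (l + 1))) * numRadius (B * A) := by ring
    _ ≤ (1 / (2 * (l + 1))) * N + (l / (4 * (l + 1))) * N
        + (l / (2 * (l + 1))) * (1 / 2 * N) := by gcongr
    _ = 1 / 2 * N := by field_simp; ring
end
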